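/- Let θ̂ be an even, rapidly decaying Fourier-side solution of the SQG equation, and define 𝒥(t) := Σ_{k∈ℤ²₊} (k₁ + 1/2) θ̂_k(t) θ̂_{k+e}(t). Then 𝒥 is differentiable on [0,∞) and d𝒥/dt (t) = σ(t) + Σ(t), where, writing S_j(t) := Σ_{l+m=j, l,m∈ℤ²∖{0,e,−e}} (l ∧ m)(1/|l| − 1/|m|) θ̂_l(t) θ̂_m(t), σ(t) := (1/2) Σ_{k∈ℤ²₊} (k₁ + 1/2)( θ̂_k(t) S_{k+e}(t) + θ̂_{k+e}(t) S_k(t) ), and Σ(t) := θ̂_e(t) Σ_{k∈ℤ²₊} k₂ (k₁ + 1/2) [ (1 − 1/|k|) θ̂_k(t)² − (1 − 1/|k+2e|) θ̂_k(t) θ̂_{k+2e}(t) − (1 − 1/|k+e|) θ̂_{k+e}(t)² + (1 − 1/|k−e|) θ̂_{k+e}(t) θ̂_{k−e}(t) ]. -/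

import Mathlib

open scoped BigOperators

noncomputable section

/-- Euclidean norm of a lattice point `k ∈ ℤ²`. -/
def znorm (k : ℤ × ℤ) : ℝ := Real.sqrt ((k.1 : ℝ) ^ 2 + (k.2 : ℝ) ^ 2)

/-- Wedge product `l ∧ m = l₁ m₂ − l₂ m₁`. -/
def wedge (l m : ℤ × ℤ) : ℝ := ((l.1 * m.2 - l.2 * m.1 : ℤ) : ℝ)

/-- The summand of the Fourier-side SQG nonlinearity at frequency `k`,
parametrized by `l` (with `m = k - l`); it is set to `0` unless `l ≠ 0` and `m ≠ 0`. -/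
def sqgSummand (a : ℤ × ℤ → ℝ) (k l : ℤ × ℤ) : ℝ :=
  if l ≠ 0 ∧ k - l ≠ 0 then
    wedge l (k - l) * (1 / znorm l - 1 / znorm (k - l)) * a l * a (k - l)
  else 0

/-- An even, rapidly decaying Fourier-side solution of the conservative SQG equation
on `[0,∞)` (modelled as a family `θ : ℝ → ℤ² → ℝ` whose defining properties are
imposed for `t ≥ 0`). -/
structure SQGSol where
  θ : ℝ → ℤ × ℤ → ℝ
  zero_mode : ∀ t : ℝ, 0 ≤ t → θ t 0 = 0
  /-- the nonlinearity is an absolutely convergent sum -/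
  rhs_summable : ∀ t : ℝ, 0 ≤ t → ∀ k : ℤ × ℤ,
    Summable fun l : ℤ × ℤ => |sqgSummand (θ t) k l|
  /-- each `t ↦ θ̂_k(t)` is differentiable on `[0,∞)` and satisfies the SQG ODE -/
  ode : ∀ (k : ℤ × ℤ) (t : ℝ), 0 ≤ t →
    HasDerivWithinAt (fun s => θ s k)
      ((1 / 2) * ∑' l : ℤ × ℤ, sqgSummand (θ t) k l) (Set.Ici 0) t
  /-- rapid decay: for every `T > 0` and `N ∈ ℕ`,
  `sup_{0 ≤ t ≤ T} sup_k (1+|k|)^N |θ̂_k(t)| < ∞` -/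
  decay : ∀ T : ℝ, 0 < T → ∀ N : ℕ, ∃ M : ℝ,
    ∀ t ∈ Set.Icc (0 : ℝ) T, ∀ k : ℤ × ℤ, (1 + znorm k) ^ N * |θ t k| ≤ M

/-- The solution is even: `θ̂_{-k}(t) = θ̂_k(t)`. -/
def SQGSol.IsEven (Θ : SQGSol) : Prop :=
  ∀ t : ℝ, 0 ≤ t → ∀ k : ℤ × ℤ, Θ.θ t (-k) = Θ.θ t k

/-- `S_j(t) = Σ_{l+m=j, l,m ∉ {0,e,−e}} (l ∧ m)(1/|l| − 1/|m|) θ̂_l(t) θ̂_m(t)`,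
parametrized by `l` (with `m = j − l`). -/
def Ssum (a : ℤ × ℤ → ℝ) (j : ℤ × ℤ) : ℝ :=
  ∑' l : ℤ × ℤ,
    if l ≠ 0 ∧ l ≠ (1, 0) ∧ l ≠ (-1, 0) ∧
        j - l ≠ 0 ∧ j - l ≠ (1, 0) ∧ j - l ≠ (-1, 0) then
      wedge l (j - l) * (1 / znorm l - 1 / znorm (j - l)) * a l * a (j - l)
    else 0

/-- The functional `𝒥(t) = Σ_{k∈ℤ²₊} (k₁+1/2) θ̂_k(t) θ̂_{k+e}(t)`. -/
def Jfun (Θ : SQGSol) (t : ℝ) : ℝ :=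
  ∑' k : ℤ × ℤ, if 1 ≤ k.2 then ((k.1 : ℝ) + 1 / 2) * Θ.θ t k * Θ.θ t (k + (1, 0)) else 0

/-- The error term `σ(t)`. -/
def sigmaTerm (Θ : SQGSol) (t : ℝ) : ℝ :=
  (1 / 2) * ∑' k : ℤ × ℤ,
    if 1 ≤ k.2 then
      ((k.1 : ℝ) + 1 / 2) *
        (Θ.θ t k * Ssum (Θ.θ t) (k + (1, 0)) + Θ.θ t (k + (1, 0)) * Ssum (Θ.θ t) k)
    else 0

/-- The main term `Σ(t)`. -/
def SigmaTerm (Θ : SQGSol) (t : ℝ) : ℝ :=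
  Θ.θ t (1, 0) * ∑' k : ℤ × ℤ,
    if 1 ≤ k.2 then
      (k.2 : ℝ) * ((k.1 : ℝ) + 1 / 2) *
        ((1 - 1 / znorm k) * Θ.θ t k ^ 2 -
          (1 - 1 / znorm (k + (2, 0))) * Θ.θ t k * Θ.θ t (k + (2, 0)) -
          (1 - 1 / znorm (k + (1, 0))) * Θ.θ t (k + (1, 0)) ^ 2 +
          (1 - 1 / znorm (k - (1, 0))) * Θ.θ t (k + (1, 0)) * Θ.θ t (k - (1, 0)))
    else 0

theorem aux_hasDeriv_tsum {ι : Type*} (f f' : ι → ℝ → ℝ) (u : ι → ℝ) (T t : ℝ)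
    (ht : 0 ≤ t) (htT : t < T) (hu : Summable u)
    (hf : ∀ i, ∀ s, 0 ≤ s → s ≤ T → HasDerivWithinAt (f i) (f' i s) (Set.Ici 0) s)
    (hb : ∀ i, ∀ s, 0 ≤ s → s ≤ T → |f' i s| ≤ u i)
    (hs : ∀ s, 0 ≤ s → s ≤ T → Summable fun i => f i s) :
    HasDerivWithinAt (fun s => ∑' i, f i s) (∑' i, f' i t) (Set.Ici 0) t := by
  rw [hasDerivWithinAt_iff_tendsto_slope]
  have hmem : ∀ᶠ s in nhdsWithin t (Set.Ici 0 \ {t}), 0 ≤ s ∧ s ≤ T := by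
    have h1 : ∀ᶠ s in nhdsWithin t (Set.Ici 0 \ {t}), s < T :=
      (eventually_lt_nhds htT).filter_mono nhdsWithin_le_nhds
    filter_upwards [h1, self_mem_nhdsWithin] with s h1 h2
    exact ⟨h2.1, h1.le⟩
  have key : Filter.Tendsto (fun s => ∑' i, slope (f i) t s)
      (nhdsWithin t (Set.Ici 0 \ {t})) (nhds (∑' i, f' i t)) := by
    refine tendsto_tsum_of_dominated_convergence (bound := u) hu ?_ ?_
    · intro i
      exact hasDerivWithinAt_iff_tendsto_slope.1 (hf i t ht htT.le)
    · filter_upwards [hmem] with s hs i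
      have hmv := (convex_Icc (0:ℝ) T).norm_image_sub_le_of_norm_hasDerivWithin_le
        (f := f i) (f' := f' i) (C := u i) (x := t) (y := s)
        (fun x hx => (hf i x hx.1 hx.2).mono Set.Icc_subset_Ici_self)
        (fun x hx => hb i x hx.1 hx.2) ⟨ht, htT.le⟩ ⟨hs.1, hs.2⟩
      rw [slope_def_field, norm_div]
      have hu0 : 0 ≤ u i := (abs_nonneg _).trans (hb i t ht htT.le)
      exact div_le_of_le_mul₀ (norm_nonneg _) hu0 hmv
  refine key.congr' ?_
  filter_upwards [hmem] with s hs'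
  simp only [slope_def_field]
  rw [tsum_div_const, (hs s hs'.1 hs'.2).tsum_sub (hs t ht htT.le)]

theorem aux_znorm_nonneg (k : ℤ × ℤ) : 0 ≤ znorm k := Real.sqrt_nonneg _

theorem aux_fst_le (k : ℤ × ℤ) : |(k.1 : ℝ)| ≤ znorm k := by
  apply Real.abs_le_sqrt; nlinarith [sq_nonneg (k.2 : ℝ)]

theorem aux_snd_le (k : ℤ × ℤ) : |(k.2 : ℝ)| ≤ znorm k := by
  apply Real.abs_le_sqrt; nlinarith [sq_nonneg (k.1 : ℝ)]

theorem aux_one_le (k : ℤ × ℤ) (hk : k ≠ 0) : 1 ≤ znorm k := by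
  by_cases h : k.1 = 0
  · have h2 : k.2 ≠ 0 := fun h2 => hk (Prod.ext h h2)
    have : (1 : ℝ) ≤ |(k.2 : ℝ)| := by exact_mod_cast Int.one_le_abs h2
    exact this.trans (aux_snd_le k)
  · have : (1 : ℝ) ≤ |(k.1 : ℝ)| := by exact_mod_cast Int.one_le_abs h
    exact this.trans (aux_fst_le k)

theorem aux_inv (k : ℤ × ℤ) : 0 ≤ 1 / znorm k ∧ 1 / znorm k ≤ 1 := by
  refine ⟨by have := aux_znorm_nonneg k; positivity, ?_⟩
  by_cases h : k = 0
  · subst h; simp [znorm]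
  · have := aux_one_le k h
    rw [div_le_one (by linarith)]; exact this

theorem aux_coef (k : ℤ × ℤ) : |1 - 1 / znorm k| ≤ 1 := by
  have := aux_inv k
  rw [abs_le]; constructor <;> linarith

theorem aux_wedge (l m : ℤ × ℤ) : |wedge l m| ≤ znorm l * znorm m := by
  unfold wedge znorm
  rw [← Real.sqrt_mul (by positivity)]
  apply Real.abs_le_sqrt
  push_cast
  nlinarith [sq_nonneg ((l.1 : ℝ) * m.1 + l.2 * m.2)]

/-- the shift inequality `1 + |k| ≤ 2 (1 + |k+e|)` -/
theorem aux_shift (k : ℤ × ℤ) : 1 + znorm k ≤ 2 * (1 + znorm (k + (1, 0))) := by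
  have h0 := aux_znorm_nonneg (k + (1, 0))
  have h1 := neg_abs_le (((k + (1, 0)).1 : ℤ) : ℝ)
  have h2 := aux_fst_le (k + (1, 0))
  have hsq : znorm (k + (1, 0)) ^ 2 = ((k.1 : ℝ) + 1) ^ 2 + (k.2 : ℝ) ^ 2 := by
    unfold znorm; rw [Real.sq_sqrt (by positivity)]; simp
  have h4 : znorm k ≤ znorm (k + (1, 0)) + 1 := by
    apply Real.sqrt_le_iff.2
    refine ⟨by linarith, ?_⟩
    have : ((k + (1, 0)).1 : ℝ) = k.1 + 1 := by simp
    rw [this] at h1 h2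
    nlinarith
  linarith

def auxW (k : ℤ × ℤ) : ℝ := ((1 + znorm k) ^ 4)⁻¹

theorem auxW_nonneg (k : ℤ × ℤ) : 0 ≤ auxW k := by
  have := aux_znorm_nonneg k
  unfold auxW; positivity

theorem auxW_summable : Summable auxW := by
  have h1 : Summable fun n : ℤ => ((1 + |(n : ℝ)|) ^ 2)⁻¹ := by
    have h0 : Summable fun n : ℤ => 1 / |(n : ℝ)| ^ 2 := by
      have := (Real.summable_one_div_int_pow (p := 2)).2 (by norm_num)
      simpa using this
    refine Summable.of_norm_bounded_eventually h0 ?_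
    have : ∀ᶠ n : ℤ in Filter.cofinite, n ≠ 0 := by
      rw [Filter.eventually_cofinite]; simp only [not_not]; exact Set.finite_singleton 0
    filter_upwards [this] with n hn
    have hp : 0 < |(n : ℝ)| := by positivity
    rw [Real.norm_of_nonneg (by positivity), one_div]
    gcongr; linarith
  have h2 := h1.mul_of_nonneg h1 (fun n => by positivity) (fun n => by positivity)
  refine Summable.of_nonneg_of_le auxW_nonneg ?_ h2
  intro k
  have ha := aux_fst_le k
  have hb := aux_snd_le k
  have hz := aux_znorm_nonneg k
  unfold auxW
  rw [← mul_inv]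
  have : (1 + |(k.1 : ℝ)|) ^ 2 * (1 + |(k.2 : ℝ)|) ^ 2 ≤ (1 + znorm k) ^ 4 := by
    calc _ ≤ (1 + znorm k) ^ 2 * (1 + znorm k) ^ 2 := by gcongr
      _ = _ := by ring
  gcongr

theorem aux_decay (Θ : SQGSol) (T : ℝ) (hT : 0 < T) : ∃ C : ℝ, 0 ≤ C ∧
    ∀ t, 0 ≤ t → t ≤ T → ∀ k : ℤ × ℤ,
      |Θ.θ t k| ≤ C ∧ (1 + znorm k) * |Θ.θ t k| ≤ C ∧
      (1 + znorm k) ^ 2 * |Θ.θ t k| ≤ C * auxW k ∧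
      (1 + znorm k) ^ 2 * |Θ.θ t (k + (1, 0))| ≤ C * auxW k := by
  obtain ⟨M, hM⟩ := Θ.decay T hT 6
  have hM0 : 0 ≤ M := by
    refine le_trans ?_ (hM 0 ⟨le_rfl, hT.le⟩ 0)
    have := aux_znorm_nonneg 0
    positivity
  refine ⟨64 * M, by positivity, fun t h0 h1 k => ?_⟩
  have hk := hM t ⟨h0, h1⟩ k
  have hk' := hM t ⟨h0, h1⟩ (k + (1, 0))
  have hz := aux_znorm_nonneg k
  have hz' := aux_znorm_nonneg (k + (1, 0))
  have ha := abs_nonneg (Θ.θ t k)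
  have ha' := abs_nonneg (Θ.θ t (k + (1, 0)))
  have e1 : (1 : ℝ) ≤ 1 + znorm k := by linarith
  have hpos : 0 < (1 + znorm k) ^ 4 := by positivity
  have A2 : (1 + znorm k) * |Θ.θ t k| ≤ (1 + znorm k) ^ 6 * |Θ.θ t k| := by
    gcongr; exact le_self_pow₀ e1 (by norm_num)
  have A1 : |Θ.θ t k| ≤ (1 + znorm k) * |Θ.θ t k| := by nlinarith
  refine ⟨by linarith, by linarith, ?_, ?_⟩
  · unfold auxW
    rw [← div_eq_mul_inv, le_div_iff₀ hpos]
    calc _ = (1 + znorm k) ^ 6 * |Θ.θ t k| := by ring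
      _ ≤ _ := by linarith
  · unfold auxW
    rw [← div_eq_mul_inv, le_div_iff₀ hpos]
    calc _ = (1 + znorm k) ^ 6 * |Θ.θ t (k + (1, 0))| := by ring
      _ ≤ (2 * (1 + znorm (k + (1, 0)))) ^ 6 * |Θ.θ t (k + (1, 0))| := by
        gcongr; exact aux_shift k
      _ = 64 * ((1 + znorm (k + (1, 0))) ^ 6 * |Θ.θ t (k + (1, 0))|) := by ring
      _ ≤ _ := by linarith

theorem aux_rhs (Θ : SQGSol) (T : ℝ) (hT : 0 < T) : ∃ D : ℝ, 0 ≤ D ∧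
    ∀ t, 0 ≤ t → t ≤ T → ∀ k : ℤ × ℤ,
      |(1 / 2) * ∑' l : ℤ × ℤ, sqgSummand (Θ.θ t) k l| ≤ D := by
  obtain ⟨C, hC, h⟩ := aux_decay Θ T hT
  have hW := auxW_summable.mul_left (C * C)
  refine ⟨∑' l, C * C * auxW l,
    tsum_nonneg fun l => mul_nonneg (mul_nonneg hC hC) (auxW_nonneg l), fun t h0 h1 k => ?_⟩
  have hb : ∀ l, ‖sqgSummand (Θ.θ t) k l‖ ≤ C * C * auxW l := by
    intro l
    unfold sqgSummand
    split_ifs with hl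
    · obtain ⟨-, -, hl2, -⟩ := h t h0 h1 l
      obtain ⟨-, hm1, -, -⟩ := h t h0 h1 (k - l)
      have hzl := aux_znorm_nonneg l
      have hzm := aux_znorm_nonneg (k - l)
      have hw := aux_wedge l (k - l)
      have hd : |1 / znorm l - 1 / znorm (k - l)| ≤ 1 := by
        have := aux_inv l
        have := aux_inv (k - l)
        rw [abs_le]; constructor <;> linarith
      have ha := abs_nonneg (Θ.θ t l)
      have ha' := abs_nonneg (Θ.θ t (k - l))
      rw [Real.norm_eq_abs, abs_mul, abs_mul, abs_mul]
      have B1 : znorm l * |Θ.θ t l| ≤ C * auxW l := by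
        refine le_trans ?_ hl2
        gcongr; nlinarith
      have B2 : znorm (k - l) * |Θ.θ t (k - l)| ≤ C := by
        refine le_trans ?_ hm1
        gcongr; linarith
      calc _ ≤ (znorm l * znorm (k - l)) * 1 * |Θ.θ t l| * |Θ.θ t (k - l)| := by gcongr
        _ = (znorm l * |Θ.θ t l|) * (znorm (k - l) * |Θ.θ t (k - l)|) := by ring
        _ ≤ (C * auxW l) * C := by
          have := auxW_nonneg l
          gcongr
        _ = _ := by ring
    · rw [norm_zero]
      exact mul_nonneg (mul_nonneg hC hC) (auxW_nonneg l)
  have := tsum_of_norm_bounded hW.hasSum hb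
  rw [Real.norm_eq_abs] at this
  rw [abs_mul, abs_of_pos (by norm_num : (0:ℝ) < 1 / 2)]
  have h3 := abs_nonneg (∑' l : ℤ × ℤ, sqgSummand (Θ.θ t) k l)
  linarith

theorem aux_split (Θ : SQGSol) (hE : Θ.IsEven) (t : ℝ) (ht : 0 ≤ t) (k : ℤ × ℤ)
    (hk : 1 ≤ k.2) :
    (1 / 2) * ∑' l : ℤ × ℤ, sqgSummand (Θ.θ t) k l =
      (1 / 2) * Ssum (Θ.θ t) k + (k.2 : ℝ) * Θ.θ t (1, 0) *
        ((1 - 1 / znorm (k - (1, 0))) * Θ.θ t (k - (1, 0)) -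
          (1 - 1 / znorm (k + (1, 0))) * Θ.θ t (k + (1, 0))) := by
  have hS : Summable fun l => sqgSummand (Θ.θ t) k l := (Θ.rhs_summable t ht k).of_abs
  let F : Finset (ℤ × ℤ) := {(1, 0), (-1, 0), k - (1, 0), k + (1, 0)}
  let g : ℤ × ℤ → ℝ := fun l => if l ∈ F then sqgSummand (Θ.θ t) k l else 0
  have hg : HasSum g (∑ l ∈ F, g l) :=
    hasSum_sum_of_ne_finset_zero (fun l hl => if_neg hl)
  have hgs : ∑ l ∈ F, g l = ∑ l ∈ F, sqgSummand (Θ.θ t) k l :=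
    Finset.sum_congr rfl fun l hl => if_pos hl
  have hSs : Ssum (Θ.θ t) k = ∑' l, (sqgSummand (Θ.θ t) k l - g l) := by
    unfold Ssum
    refine tsum_congr fun l => ?_
    have e1 : k - l = (1, 0) ↔ l = k - (1, 0) := by
      obtain ⟨a, b⟩ := k
      obtain ⟨c, d⟩ := l
      simp only [Prod.mk_sub_mk, Prod.mk.injEq]
      omega
    have e2 : k - l = (-1, 0) ↔ l = k + (1, 0) := by
      obtain ⟨a, b⟩ := k
      obtain ⟨c, d⟩ := l
      simp only [Prod.mk_sub_mk, Prod.mk_add_mk, Prod.mk.injEq]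
      omega
    by_cases hl : l ∈ F
    · have : g l = sqgSummand (Θ.θ t) k l := if_pos hl
      rw [this, sub_self, if_neg]
      simp only [F, Finset.mem_insert, Finset.mem_singleton] at hl
      rw [ne_eq, ne_eq, ne_eq, ne_eq, ne_eq, ne_eq, e1, e2]
      tauto
    · have : g l = 0 := if_neg hl
      rw [this, sub_zero]
      simp only [F, Finset.mem_insert, Finset.mem_singleton, not_or] at hl
      unfold sqgSummand
      congr 1
      rw [ne_eq, ne_eq, ne_eq, ne_eq, ne_eq, ne_eq, e1, e2]
      simp only [eq_iff_iff]
      tauto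
  have hSum : ∑' l, sqgSummand (Θ.θ t) k l =
      Ssum (Θ.θ t) k + ∑ l ∈ F, sqgSummand (Θ.θ t) k l := by
    rw [hSs, hS.tsum_sub hg.summable, hg.tsum_eq, hgs]; ring
  have hFs : ∑ l ∈ F, sqgSummand (Θ.θ t) k l =
      sqgSummand (Θ.θ t) k (1, 0) + (sqgSummand (Θ.θ t) k (-1, 0) +
        (sqgSummand (Θ.θ t) k (k - (1, 0)) + sqgSummand (Θ.θ t) k (k + (1, 0)))) := by
    obtain ⟨a, b⟩ := k
    simp only at hk
    simp only [F]
    rw [Finset.sum_insert, Finset.sum_insert, Finset.sum_insert, Finset.sum_singleton]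
    all_goals
      simp only [Finset.mem_insert, Finset.mem_singleton, Prod.mk_sub_mk, Prod.mk_add_mk,
        Prod.mk.injEq]
      omega
  have n1 : znorm (1, 0) = 1 := by simp [znorm]
  have n2 : znorm (-1, 0) = 1 := by simp [znorm]
  have hev : Θ.θ t (-1, 0) = Θ.θ t (1, 0) := by
    have := hE t ht (1, 0)
    simpa using this
  have ne : ∀ l : ℤ × ℤ, l.2 ≠ 0 → l ≠ 0 := fun l hl h => hl (by rw [h]; rfl)
  have d1 : k - (-1, 0) = k + (1, 0) := by ext <;> simp
  have d2 : k - (k - (1, 0)) = (1, 0) := by simp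
  have d3 : k - (k + (1, 0)) = (-1, 0) := by ext <;> simp
  have p1 : k - (1, 0) ≠ 0 := ne _ (by simp; omega)
  have p2 : k + (1, 0) ≠ 0 := ne _ (by simp; omega)
  have p3 : ((1, 0) : ℤ × ℤ) ≠ 0 := by decide
  have p4 : ((-1, 0) : ℤ × ℤ) ≠ 0 := by decide
  rw [hSum, hFs]
  unfold sqgSummand
  rw [d1, d2, d3, if_pos ⟨p3, p1⟩, if_pos ⟨p4, p2⟩, if_pos ⟨p1, p3⟩, if_pos ⟨p2, p4⟩,
    n1, n2, hev]
  have w1 : wedge (1, 0) (k - (1, 0)) = k.2 := by simp [wedge]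
  have w2 : wedge (-1, 0) (k + (1, 0)) = -k.2 := by simp [wedge]
  have w3 : wedge (k - (1, 0)) (1, 0) = -k.2 := by simp [wedge]
  have w4 : wedge (k + (1, 0)) (-1, 0) = k.2 := by simp [wedge]
  rw [w1, w2, w3, w4]
  ring

theorem aux_half (k : ℤ × ℤ) : |(k.1 : ℝ) + 1 / 2| ≤ 1 + znorm k := by
  have h := aux_fst_le k
  have := abs_add_le (k.1 : ℝ) (1 / 2)
  rw [abs_of_pos (by norm_num : (0:ℝ) < 1 / 2)] at this
  linarith

theorem aux_Sigma_summable (Θ : SQGSol) (t : ℝ) (ht : 0 ≤ t) :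
    Summable fun k : ℤ × ℤ => if 1 ≤ k.2 then
      (k.2 : ℝ) * ((k.1 : ℝ) + 1 / 2) *
        ((1 - 1 / znorm k) * Θ.θ t k ^ 2 -
          (1 - 1 / znorm (k + (2, 0))) * Θ.θ t k * Θ.θ t (k + (2, 0)) -
          (1 - 1 / znorm (k + (1, 0))) * Θ.θ t (k + (1, 0)) ^ 2 +
          (1 - 1 / znorm (k - (1, 0))) * Θ.θ t (k + (1, 0)) * Θ.θ t (k - (1, 0)))
    else 0 := by
  obtain ⟨C, hC, h⟩ := aux_decay Θ (t + 1) (by linarith)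
  have hh := h t ht (by linarith)
  refine Summable.of_norm_bounded (auxW_summable.mul_left (4 * C * C)) fun k => ?_
  have hW := auxW_nonneg k
  split_ifs with hk
  · obtain ⟨b0, -, b1, b2⟩ := hh k
    have b3 := (hh (k + (1, 0))).1
    have b4 := (hh (k + (2, 0))).1
    have b5 := (hh (k - (1, 0))).1
    have c1 := aux_coef k
    have c2 := aux_coef (k + (1, 0))
    have c3 := aux_coef (k + (2, 0))
    have c4 := aux_coef (k - (1, 0))
    have hz := aux_znorm_nonneg k
    have hhalf := aux_half k
    have h2 : |(k.2 : ℝ)| ≤ 1 + znorm k := by linarith [aux_snd_le k]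
    have T : ∀ c x y : ℝ, |c| ≤ 1 → |y| ≤ C → (1 + znorm k) ^ 2 * |x| ≤ C * auxW k →
        |(k.2 : ℝ) * ((k.1 : ℝ) + 1 / 2) * (c * x * y)| ≤ C * C * auxW k := by
      intro c x y hc hy hx
      rw [abs_mul, abs_mul, abs_mul, abs_mul]
      calc _ ≤ (1 + znorm k) * (1 + znorm k) * (1 * |x| * C) := by gcongr
        _ = ((1 + znorm k) ^ 2 * |x|) * C := by ring
        _ ≤ (C * auxW k) * C := by gcongr
        _ = _ := by ring
    have t1 := T _ _ _ c1 b0 b1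
    have t2 := T _ _ _ c3 b4 b1
    have t3 := T _ _ _ c2 b3 b2
    have t4 := T _ _ _ c4 b5 b2
    rw [abs_le] at t1 t2 t3 t4
    rw [Real.norm_eq_abs, abs_le]
    constructor <;> nlinarith
  · rw [norm_zero]; positivity


/-- Differentiating the functional `𝒥` along an even rapidly decaying Fourier-side SQG
solution gives `d𝒥/dt = σ + Σ` on `[0,∞)`. -/
theorem J_derivative (Θ : SQGSol) (hE : Θ.IsEven) :
    ∀ t : ℝ, 0 ≤ t →
      HasDerivWithinAt (Jfun Θ) (sigmaTerm Θ t + SigmaTerm Θ t) (Set.Ici 0) t := by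
  intro t ht
  have hT : 0 < t + 1 := by linarith
  obtain ⟨C, hC, h⟩ := aux_decay Θ (t + 1) hT
  obtain ⟨D, hD, hR⟩ := aux_rhs Θ (t + 1) hT
  let R : ℝ → ℤ × ℤ → ℝ := fun s k => (1 / 2) * ∑' l : ℤ × ℤ, sqgSummand (Θ.θ s) k l
  let f : ℤ × ℤ → ℝ → ℝ := fun k s =>
    if 1 ≤ k.2 then ((k.1 : ℝ) + 1 / 2) * Θ.θ s k * Θ.θ s (k + (1, 0)) else 0
  let f' : ℤ × ℤ → ℝ → ℝ := fun k s =>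
    if 1 ≤ k.2 then ((k.1 : ℝ) + 1 / 2) *
      (Θ.θ s k * R s (k + (1, 0)) + Θ.θ s (k + (1, 0)) * R s k) else 0
  have hu : Summable fun k => 2 * C * D * auxW k := auxW_summable.mul_left _
  have hstep : ∀ (k : ℤ × ℤ) (x y B : ℝ), 0 ≤ B → |y| ≤ B →
      (1 + znorm k) ^ 2 * |x| ≤ C * auxW k →
      |((k.1 : ℝ) + 1 / 2) * (x * y)| ≤ C * B * auxW k := by
    intro k x y B hB hy hx
    have hz := aux_znorm_nonneg k
    rw [abs_mul, abs_mul]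
    have hhalf : |(k.1 : ℝ) + 1 / 2| ≤ (1 + znorm k) ^ 2 := by
      have := aux_half k
      nlinarith
    calc _ ≤ (1 + znorm k) ^ 2 * (|x| * B) := by gcongr
      _ = ((1 + znorm k) ^ 2 * |x|) * B := by ring
      _ ≤ (C * auxW k) * B := by gcongr
      _ = _ := by ring
  have hb : ∀ k, ∀ s, 0 ≤ s → s ≤ t + 1 → |f' k s| ≤ 2 * C * D * auxW k := by
    intro k s h0 h1
    have hW := auxW_nonneg k
    simp only [f']
    split_ifs with hk
    · obtain ⟨-, -, b1, b2⟩ := h s h0 h1 k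
      have t1 := hstep k _ _ D hD (hR s h0 h1 (k + (1, 0))) b1
      have t2 := hstep k _ _ D hD (hR s h0 h1 k) b2
      rw [mul_add]
      refine (abs_add_le _ _).trans ?_
      simp only [R]
      linarith
    · rw [abs_zero]; positivity
  have hs : ∀ s, 0 ≤ s → s ≤ t + 1 → Summable fun k => f k s := by
    intro s h0 h1
    refine Summable.of_norm_bounded (auxW_summable.mul_left (C * C)) fun k => ?_
    have hW := auxW_nonneg k
    simp only [f]
    split_ifs with hk
    · obtain ⟨-, -, b1, -⟩ := h s h0 h1 k
      rw [mul_assoc]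
      exact hstep k _ _ C hC (h s h0 h1 (k + (1, 0))).1 b1
    · rw [norm_zero]; positivity
  have hf : ∀ k, ∀ s, 0 ≤ s → s ≤ t + 1 →
      HasDerivWithinAt (f k) (f' k s) (Set.Ici 0) s := by
    intro k s h0 h1
    by_cases hk : 1 ≤ k.2
    · simp only [f, f', if_pos hk]
      have d1 := Θ.ode k s h0
      have d2 := Θ.ode (k + (1, 0)) s h0
      refine ((d1.const_mul ((k.1 : ℝ) + 1 / 2)).mul d2).congr_deriv ?_
      simp only [R]
      ring
    · simp only [f, f', if_neg hk]
      exact hasDerivWithinAt_const _ _ _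
  have main := aux_hasDeriv_tsum f f' _ (t + 1) t ht (by linarith) hu hf hb hs
  have hfSum : Summable fun k => f' k t :=
    Summable.of_norm_bounded hu fun k => hb k t ht (by linarith)
  have hSig := (aux_Sigma_summable Θ t ht).mul_left (Θ.θ t (1, 0))
  refine HasDerivWithinAt.congr_deriv (f := Jfun Θ) main ?_
  have hsub := hfSum.tsum_sub hSig
  have hsig : sigmaTerm Θ t = ∑' k, (f' k t - Θ.θ t (1, 0) * if 1 ≤ k.2 then
      (k.2 : ℝ) * ((k.1 : ℝ) + 1 / 2) *
        ((1 - 1 / znorm k) * Θ.θ t k ^ 2 -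
          (1 - 1 / znorm (k + (2, 0))) * Θ.θ t k * Θ.θ t (k + (2, 0)) -
          (1 - 1 / znorm (k + (1, 0))) * Θ.θ t (k + (1, 0)) ^ 2 +
          (1 - 1 / znorm (k - (1, 0))) * Θ.θ t (k + (1, 0)) * Θ.θ t (k - (1, 0)))
    else 0) := by
    unfold sigmaTerm
    rw [← tsum_mul_left]
    refine tsum_congr fun k => ?_
    by_cases hk : 1 ≤ k.2
    · simp only [f', R, if_pos hk]
      rw [aux_split Θ hE t ht k hk, aux_split Θ hE t ht (k + (1, 0)) (by simpa using hk)]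
      have e1 : k + (1, 0) - (1, 0) = k := by simp
      have e2 : k + (1, 0) + (1, 0) = k + (2, 0) := by ext <;> simp; ring
      have e3 : (k + (1, 0)).2 = k.2 := by simp
      rw [e1, e2, e3]
      ring
    · simp only [f', if_neg hk]; ring
  rw [hsig, hsub, tsum_mul_left]
  unfold SigmaTerm
  ring
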